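/- Let A ∈ ℝ^{m×n} and T ⊆ {1,…,n}. Suppose basis pursuit uniquely recovers every vector supported on T, i.e. for every z ∈ ℝⁿ with zᵢ = 0 for all i ∉ T, z is the unique minimizer of ‖x‖₁ subject to Ax = Az. Then for every x̄ supported on T and every w ∈ ℝⁿ of the form wᵢ = sgn(x̄ᵢ)·(1 − θᵢ) with θᵢ ∈ [0,1], x̄ is the unique minimizer of ‖x‖₁ − ⟨w, x⟩ subject to Ax = Ax̄. -/

import Mathlib

/-- The null space property: if basis pursuit uniquely recovers every vector supported on `T`, then
every nonzero kernel vector has strictly smaller `ℓ₁` mass on `T` than off `T`. -/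
theorem sum_ite_abs_pos_of_uniform_recovery {ι κ : Type*} [Fintype ι] [DecidableEq ι]
    (A : Matrix κ ι ℝ) (T : Finset ι)
    (hBP : ∀ z : ι → ℝ, (∀ i ∉ T, z i = 0) →
      ∀ x : ι → ℝ, A.mulVec x = A.mulVec z → x ≠ z → ∑ i, |z i| < ∑ i, |x i|)
    (h : ι → ℝ) (hA : A.mulVec h = 0) (h0 : h ≠ 0) :
    0 < ∑ i, (if i ∈ T then -|h i| else |h i|) := by
  let z : ι → ℝ := fun i => if i ∈ T then -h i else 0
  have hx : ∀ i, (z + h) i = if i ∈ T then 0 else h i := by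
    intro i
    by_cases hi : i ∈ T <;> simp [z, hi]
  have key := hBP z (fun i hi => by simp [z, hi]) (z + h) (by rw [Matrix.mulVec_add, hA, add_zero])
    (by simpa using h0)
  rw [← sub_pos, ← Finset.sum_sub_distrib] at key
  refine key.trans_eq (Finset.sum_congr rfl fun i _ => ?_)
  rw [hx]
  by_cases hi : i ∈ T <;> simp [z, hi]

/-- The scalar subgradient bound for `t ↦ |t| - w t` with `w = sign a * (1 - θ)`. -/
theorem abs_sub_sign_mul_le {a θ : ℝ} (hθ : θ ∈ Set.Icc (0 : ℝ) 1) (x : ℝ) :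
    |a| - Real.sign a * (1 - θ) * a - |x - a| ≤ |x| - Real.sign a * (1 - θ) * x := by
  obtain ⟨h0, h1⟩ := hθ
  rcases lt_trichotomy a 0 with ha | rfl | ha
  · rw [Real.sign_of_neg ha, abs_of_neg ha]
    nlinarith [neg_le_abs x, le_abs_self (x - a), abs_nonneg (x - a),
      mul_le_mul_of_nonneg_left (le_abs_self (x - a)) h0,
      mul_le_mul_of_nonneg_right h1 (abs_nonneg (x - a))]
  · simp only [Real.sign_zero, abs_zero, zero_mul, sub_zero]
    linarith [abs_nonneg x]
  · rw [Real.sign_of_pos ha, abs_of_pos ha]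
    nlinarith [le_abs_self x, neg_le_abs (x - a), abs_nonneg (x - a),
      mul_le_mul_of_nonneg_left (neg_le_abs (x - a)) h0,
      mul_le_mul_of_nonneg_right h1 (abs_nonneg (x - a))]

/-- support-wise uniform recovery: If basis pursuit uniquely recovers every
vector supported on `T`, then for every `x̄` supported on `T` and every weight
`w i = sgn(x̄ i) * (1 - θ i)` with `θ i ∈ [0,1]`, `x̄` is the unique minimizer of
`‖x‖₁ - ⟨w, x⟩` subject to `A x = A x̄`. -/
theorem stmt8 (m n : ℕ) (A : Matrix (Fin m) (Fin n) ℝ) (T : Finset (Fin n))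
    (hBP : ∀ z : Fin n → ℝ, (∀ i ∉ T, z i = 0) →
      ∀ x : Fin n → ℝ, A.mulVec x = A.mulVec z → x ≠ z →
        ∑ i, |z i| < ∑ i, |x i|) :
    ∀ xbar : Fin n → ℝ, (∀ i ∉ T, xbar i = 0) →
      ∀ w θ : Fin n → ℝ, (∀ i, θ i ∈ Set.Icc (0 : ℝ) 1) →
        (∀ i, w i = Real.sign (xbar i) * (1 - θ i)) →
        ∀ x : Fin n → ℝ, A.mulVec x = A.mulVec xbar → x ≠ xbar →
          (∑ i, |xbar i|) - ∑ i, w i * xbar i < (∑ i, |x i|) - ∑ i, w i * x i := by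
  intro xbar hsupp w θ hθ hw x hA hne
  have key := sum_ite_abs_pos_of_uniform_recovery A T hBP (x - xbar)
    (by rw [Matrix.mulVec_sub, hA, sub_self]) (sub_ne_zero.mpr hne)
  rw [← Finset.sum_sub_distrib, ← Finset.sum_sub_distrib]
  refine (lt_add_of_pos_right _ key).trans_le ?_
  rw [← Finset.sum_add_distrib]
  refine Finset.sum_le_sum fun i _ => ?_
  by_cases hi : i ∈ T
  · simpa [hi, hw, sub_eq_add_neg] using abs_sub_sign_mul_le (a := xbar i) (hθ i) (x i)
  · simp [hi, hw, hsupp i hi]
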